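/- Let 𝒳 be a measurable space with probability measure 𝒟 and let ρ: 𝒳 → ℂ^{2^N × 2^N} be a measurable family of pure-state density matrices. Let x^{(1)}, …, x^{(M)} be i.i.d. samples from 𝒟, let ρ̄_M = (1/M)·Σ_{m=1}^M ρ(x^{(m)}) and E[ρ] = E_{x~𝒟}[ρ(x)]. Then for every ε ∈ (0,1), with probability at least 1 − 2·exp(−M·ε²/2) over the samples: |Tr[ρ̄_M²] − Tr[(E[ρ])²]| ≤ ε + (1 − Tr[(E[ρ])²])/M ≤ ε + 1/M. Hence the purity of the empirical average state converges to the purity of the expected state as M → ∞, so the empirical Petz–Rényi-2 divergence log₂(2^N·Tr[ρ̄_M²]) can be used as a surrogate for log₂(2^N·Tr[(E[ρ])²]). -/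

import Mathlib

open Matrix MeasureTheory
open scoped ComplexOrder ENNReal

noncomputable section

open ProbabilityTheory
open scoped NNReal

lemma integrable_of_measurable_of_abs_le {Ω : Type*} [MeasurableSpace Ω] {μ : Measure Ω}
    [IsFiniteMeasure μ] {f : Ω → ℝ} (hf : Measurable f) {B : ℝ} (hB : ∀ ω, |f ω| ≤ B) :
    Integrable f μ :=
  .of_bound hf.aestronglyMeasurable B (.of_forall hB)

/-- Hoeffding's lemma for a random variable of bounded oscillation. -/
lemma hasSubgaussianMGF_of_abs_sub_le {Ω : Type*} [MeasurableSpace Ω] {μ : Measure Ω}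
    [IsProbabilityMeasure μ] {f : Ω → ℝ} (hf : Measurable f) {c : ℝ≥0}
    (hc : ∀ x y, |f x - f y| ≤ c) :
    HasSubgaussianMGF (fun ω => f ω - ∫ x, f x ∂μ) ((c / 2) ^ 2) μ := by
  obtain ⟨ω₀⟩ := nonempty_of_isProbabilityMeasure μ
  have hbdd : BddBelow (Set.range f) := ⟨f ω₀ - c, by
    rintro _ ⟨x, rfl⟩
    linarith [(abs_le.1 (hc ω₀ x)).2]⟩
  have hne : Nonempty Ω := ⟨ω₀⟩
  have h := hasSubgaussianMGF_of_mem_Icc (μ := μ) (X := f) (a := ⨅ x, f x)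
    (b := (⨅ x, f x) + c) hf.aemeasurable (.of_forall fun x => ⟨ciInf_le hbdd x, by
      have : f x - c ≤ ⨅ y, f y := le_ciInf fun y => by linarith [(abs_le.1 (hc x y)).2]
      linarith⟩)
  simpa using h

/-- McDiarmid's bounded differences inequality, in sub-Gaussian form. -/
lemma hasSubgaussianMGF_pi_of_bounded_differences {𝒳 : Type*} [MeasurableSpace 𝒳]
    (D : Measure 𝒳) [IsProbabilityMeasure D] {B : ℝ} {c : ℝ≥0} (n : ℕ) (f : (Fin n → 𝒳) → ℝ)
    (hf : Measurable f) (hB : ∀ X, |f X| ≤ B)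
    (hc : ∀ i X Y, (∀ j, j ≠ i → X j = Y j) → |f X - f Y| ≤ c) :
    HasSubgaussianMGF (fun X => f X - ∫ Y, f Y ∂(Measure.pi fun _ => D))
      (n * (c / 2) ^ 2) (Measure.pi fun _ => D) := by
  induction n with
  | zero =>
    have h0 : (fun X => f X - ∫ Y, f Y ∂(Measure.pi fun _ => D)) = fun _ => 0 := by
      funext X
      simp [integral_unique, Subsingleton.elim X default]
    rw [h0]
    simp
  | succ n ih =>
    set P : Measure (Fin n → 𝒳) := Measure.pi fun _ => D
    set m := ∫ Y, f Y ∂(Measure.pi fun _ => D) with hm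
    let e := (MeasurableEquiv.piFinSuccAbove (fun _ : Fin (n + 1) => 𝒳) 0).symm
    have he : MeasurePreserving e (D.prod P) (Measure.pi fun _ => D) :=
      (measurePreserving_piFinSuccAbove (fun _ : Fin (n + 1) => D) 0).symm
    have hez : ∀ x y, e (x, y) 0 = x := fun x y => by
      simp [e, MeasurableEquiv.piFinSuccAbove_symm_apply]
    have hes : ∀ x y i, e (x, y) (Fin.succ i) = y i := fun x y i => by
      simp [e, MeasurableEquiv.piFinSuccAbove_symm_apply]
    have hφ : Measurable fun p => f (e p) := hf.comp e.measurable
    have hφx : ∀ x, Measurable fun y => f (e (x, y)) := fun x => hφ.comp measurable_prodMk_left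
    have hφi : ∀ x, Integrable (fun y => f (e (x, y))) P := fun x =>
      integrable_of_measurable_of_abs_le (hφx x) fun _ => hB _
    set g : 𝒳 → ℝ := fun x => ∫ y, f (e (x, y)) ∂P with hg
    have hgm : Measurable g := hφ.stronglyMeasurable.integral_prod_right'.measurable
    have hgc : ∀ x x', |g x - g x'| ≤ c := fun x x' => by
      rw [hg, ← integral_sub (hφi x) (hφi x')]
      have h := norm_integral_le_of_norm_le_const (μ := P) (C := c)
        (f := fun y => f (e (x, y)) - f (e (x', y))) (.of_forall fun y => ?_)
      · simpa using h
      refine hc 0 _ _ fun j hj => ?_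
      obtain ⟨i, rfl⟩ := Fin.exists_succ_eq.2 hj
      rw [hes, hes]
    have hmg : m = ∫ x, g x ∂D := by
      rw [hm, ← he.integral_comp', integral_prod]
      exact integrable_of_measurable_of_abs_le hφ fun _ => hB _
    have hg_sub := hasSubgaussianMGF_of_abs_sub_le (μ := D) hgm hgc
    rw [← hmg] at hg_sub
    have ihx := fun x => ih (fun y => f (e (x, y))) (hφx x) (fun _ => hB _) fun i X Y h => by
      refine hc i.succ _ _ fun j hj => ?_
      induction j using Fin.cases with
      | zero => rw [hez, hez]
      | succ j => rw [hes, hes]; exact h j fun h' => hj (by rw [h'])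
    have hexp : ∀ t, Integrable (fun X => Real.exp (t * (f X - m)))
        (Measure.pi fun _ : Fin (n + 1) => D) := fun t =>
      integrable_of_measurable_of_abs_le (B := Real.exp (|t| * (B + |m|)))
        (by fun_prop) fun X => by
        rw [Real.abs_exp]
        refine Real.exp_le_exp.2 ((le_abs_self _).trans ?_)
        rw [abs_mul]
        gcongr
        exact (abs_sub _ _).trans (by gcongr; exact hB X)
    refine ⟨hexp, fun t => ?_⟩
    have hexp' : Integrable (fun p => Real.exp (t * (f (e p) - m))) (D.prod P) :=
      (he.integrable_comp_emb e.measurableEmbedding).2 (hexp t)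
    calc mgf (fun X => f X - m) (Measure.pi fun _ : Fin (n + 1) => D) t
        = ∫ x, ∫ y, Real.exp (t * (f (e (x, y)) - m)) ∂P ∂D := by
          rw [mgf, ← he.integral_comp', integral_prod _ hexp']
      _ ≤ ∫ x, Real.exp ((n * (c / 2) ^ 2 : ℝ≥0) * t ^ 2 / 2) * Real.exp (t * (g x - m)) ∂D := by
          refine integral_mono hexp'.integral_prod_left
            ((hg_sub.integrable_exp_mul t).const_mul _) fun x => ?_
          have h1 : ∀ y, Real.exp (t * (f (e (x, y)) - m))
              = Real.exp (t * (f (e (x, y)) - g x)) * Real.exp (t * (g x - m)) := fun y => by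
            rw [← Real.exp_add]; ring_nf
          simp only [h1, integral_mul_const]
          gcongr
          exact (ihx x).mgf_le t
      _ ≤ Real.exp ((n * (c / 2) ^ 2 : ℝ≥0) * t ^ 2 / 2)
            * Real.exp (((c / 2) ^ 2 : ℝ≥0) * t ^ 2 / 2) := by
          rw [integral_const_mul]
          gcongr
          exact hg_sub.mgf_le t
      _ = Real.exp (((n + 1 : ℕ) * (c / 2) ^ 2 : ℝ≥0) * t ^ 2 / 2) := by
          rw [← Real.exp_add]
          push_cast
          ring_nf

lemma measurePreserving_pi_eval_pair {ι 𝒳 : Type*} [Fintype ι] [MeasurableSpace 𝒳]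
    (D : Measure 𝒳) [IsProbabilityMeasure D] {a b : ι} (hab : a ≠ b) :
    MeasurePreserving (fun X : ι → 𝒳 => (X a, X b)) (Measure.pi fun _ => D) (D.prod D) := by
  refine ⟨by fun_prop, ?_⟩
  have h := ((iIndepFun_pi (μ := fun _ : ι => D) (X := fun _ x => x)
    fun _ => aemeasurable_id).indepFun hab).map_prod_eq_prod_map_map
    (measurable_pi_apply a).aemeasurable (measurable_pi_apply b).aemeasurable
  rw [h]
  congr 1
  · exact (measurePreserving_eval (fun _ : ι => D) a).map_eq
  · exact (measurePreserving_eval (fun _ : ι => D) b).map_eq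

/-- Changing one sample changes a V-statistic of a `[0, 1]`-valued kernel by at most `2 / M`. -/
lemma abs_vStatistic_sub_le {𝒳 : Type*} {M : ℕ} {K : 𝒳 → 𝒳 → ℝ} (hM : 1 ≤ M)
    (h01 : ∀ x y, K x y ∈ Set.Icc 0 1) (hdiag : ∀ x, K x x = 1) (i : Fin M)
    (X Y : Fin M → 𝒳) (h : ∀ j, j ≠ i → X j = Y j) :
    |((M : ℝ) ^ 2)⁻¹ * ∑ a, ∑ b, K (X a) (X b) - ((M : ℝ) ^ 2)⁻¹ * ∑ a, ∑ b, K (Y a) (Y b)|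
      ≤ 2 / M := by
  have hterm : ∀ a b, |K (X a) (X b) - K (Y a) (Y b)|
      ≤ (if a = i then 1 else 0) + if b = i then 1 else 0 := by
    intro a b
    have h1 : |K (X a) (X b) - K (Y a) (Y b)| ≤ 1 := by
      have h1 := h01 (X a) (X b)
      have h2 := h01 (Y a) (Y b)
      exact abs_le.2 ⟨by linarith [h1.1, h2.2], by linarith [h1.2, h2.1]⟩
    by_cases ha : a = i
    · by_cases hb : b = i
      · simp [ha, hb, hdiag]
      · simpa [ha, hb] using ha ▸ h1
    · by_cases hb : b = i
      · simpa [ha, hb] using hb ▸ h1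
      · simp [ha, hb, h a ha, h b hb]
  rw [← mul_sub, ← Finset.sum_sub_distrib, abs_mul, abs_of_nonneg (by positivity)]
  simp_rw [← Finset.sum_sub_distrib]
  calc ((M : ℝ) ^ 2)⁻¹ * |∑ a, ∑ b, (K (X a) (X b) - K (Y a) (Y b))|
      ≤ ((M : ℝ) ^ 2)⁻¹ * ∑ a : Fin M, ∑ b : Fin M,
          ((if a = i then 1 else 0) + if b = i then 1 else 0) := by
        gcongr
        refine (Finset.abs_sum_le_sum_abs _ _).trans (Finset.sum_le_sum fun a _ => ?_)
        exact (Finset.abs_sum_le_sum_abs _ _).trans (Finset.sum_le_sum fun b _ => hterm a b)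
    _ = 2 / M := by
        have : (M : ℝ) ≠ 0 := by positivity
        simp [Finset.sum_add_distrib]
        field_simp
        norm_num

section VStatistic

variable {𝒳 : Type*} [MeasurableSpace 𝒳] (D : Measure 𝒳) [IsProbabilityMeasure D] {M : ℕ}
  {K : 𝒳 → 𝒳 → ℝ}

lemma integral_vStatistic (hM : 1 ≤ M) (hK : Measurable fun p : 𝒳 × 𝒳 => K p.1 p.2)
    (h01 : ∀ x y, K x y ∈ Set.Icc 0 1) (hdiag : ∀ x, K x x = 1) :
    ∫ X, ((M : ℝ) ^ 2)⁻¹ * ∑ a, ∑ b, K (X a) (X b) ∂(Measure.pi fun _ : Fin M => D)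
      = (∫ x, ∫ y, K x y ∂D ∂D) + (1 - ∫ x, ∫ y, K x y ∂D ∂D) / M := by
  have habs : ∀ x y, |K x y| ≤ 1 := fun x y => abs_le.2 ⟨by linarith [(h01 x y).1], (h01 x y).2⟩
  have hmeas : ∀ a b : Fin M, Measurable fun X : Fin M → 𝒳 => K (X a) (X b) := fun a b =>
    hK.comp (g := fun p : 𝒳 × 𝒳 => K p.1 p.2) (f := fun X : Fin M → 𝒳 => (X a, X b)) (by fun_prop)
  have hint : ∀ a b : Fin M, Integrable (fun X : Fin M → 𝒳 => K (X a) (X b))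
      (Measure.pi fun _ => D) := fun a b =>
    integrable_of_measurable_of_abs_le (hmeas a b) fun _ => habs _ _
  have hpair : ∀ a b : Fin M, ∫ X : Fin M → 𝒳, K (X a) (X b) ∂(Measure.pi fun _ => D)
      = (∫ x, ∫ y, K x y ∂D ∂D) + if a = b then 1 - ∫ x, ∫ y, K x y ∂D ∂D else 0 := by
    intro a b
    split_ifs with h
    · subst h
      simp [hdiag]
    · have hp := measurePreserving_pi_eval_pair D h
      have := integral_map (μ := Measure.pi fun _ : Fin M => D) hp.measurable.aemeasurable
        (f := fun p : 𝒳 × 𝒳 => K p.1 p.2) hK.aestronglyMeasurable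
      rw [← this, hp.map_eq, integral_prod, add_zero]
      exact integrable_of_measurable_of_abs_le hK fun _ => habs _ _
  rw [integral_const_mul, integral_finsetSum _ fun a _ => integrable_finsetSum _ fun b _ => hint a b]
  simp_rw [integral_finsetSum _ fun b _ => hint _ b, hpair, Finset.sum_add_distrib]
  have : (M : ℝ) ≠ 0 := by positivity
  simp
  field_simp

/-- Concentration of the V-statistic of a `[0, 1]`-valued kernel equal to `1` on the diagonal. -/
lemma le_measure_abs_vStatistic_sub_le (hM : 1 ≤ M)
    (hK : Measurable fun p : 𝒳 × 𝒳 => K p.1 p.2) (h01 : ∀ x y, K x y ∈ Set.Icc 0 1)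
    (hdiag : ∀ x, K x x = 1) {ε : ℝ} (hε : 0 ≤ ε) :
    ENNReal.ofReal (1 - 2 * Real.exp (-(M : ℝ) * ε ^ 2 / 2)) ≤
      (Measure.pi fun _ : Fin M => D)
        {X | |((M : ℝ) ^ 2)⁻¹ * (∑ a, ∑ b, K (X a) (X b)) - ∫ x, ∫ y, K x y ∂D ∂D|
          ≤ ε + (1 - ∫ x, ∫ y, K x y ∂D ∂D) / M} := by
  set p := ∫ x, ∫ y, K x y ∂D ∂D
  set μ := Measure.pi fun _ : Fin M => D
  set F : (Fin M → 𝒳) → ℝ := fun X => ((M : ℝ) ^ 2)⁻¹ * ∑ a, ∑ b, K (X a) (X b) with hF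
  have hM0 : (0 : ℝ) < M := by positivity
  have hmeas : ∀ a b : Fin M, Measurable fun X : Fin M → 𝒳 => K (X a) (X b) := fun a b =>
    hK.comp (g := fun p : 𝒳 × 𝒳 => K p.1 p.2) (f := fun X : Fin M → 𝒳 => (X a, X b)) (by fun_prop)
  have hFm : Measurable F := (Finset.measurable_fun_sum _ fun a _ =>
    Finset.measurable_fun_sum _ fun b _ => hmeas a b).const_mul _
  have habs : ∀ x y, |K x y| ≤ 1 := fun x y => abs_le.2 ⟨by linarith [(h01 x y).1], (h01 x y).2⟩
  have hFB : ∀ X, |F X| ≤ 1 := fun X => by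
    rw [hF, abs_mul, abs_of_nonneg (by positivity)]
    calc ((M : ℝ) ^ 2)⁻¹ * |∑ a, ∑ b, K (X a) (X b)|
        ≤ ((M : ℝ) ^ 2)⁻¹ * ∑ a : Fin M, ∑ b : Fin M, 1 := by
          gcongr
          refine (Finset.abs_sum_le_sum_abs _ _).trans (Finset.sum_le_sum fun a _ => ?_)
          exact (Finset.abs_sum_le_sum_abs _ _).trans (Finset.sum_le_sum fun b _ => habs _ _)
      _ = 1 := by
          simp
          field_simp
  have hsub := hasSubgaussianMGF_pi_of_bounded_differences D (c := 2 / M) M F hFm hFB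
    fun i X Y h => by simpa using abs_vStatistic_sub_le hM h01 hdiag i X Y h
  have hEF : ∫ X, F X ∂μ = p + (1 - p) / M := integral_vStatistic D hM hK h01 hdiag
  have hp1 : 0 ≤ (1 - p) / M := by
    have h1 : ∀ x, |∫ y, K x y ∂D| ≤ 1 := fun x => by
      simpa using norm_integral_le_of_norm_le_const (μ := D) (f := K x) (C := 1)
        (.of_forall fun y => habs x y)
    have h2 : |p| ≤ 1 := by
      simpa using norm_integral_le_of_norm_le_const (μ := D) (f := fun x => ∫ y, K x y ∂D) (C := 1)
        (.of_forall h1)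
    have := (abs_le.1 h2).2
    exact div_nonneg (by linarith) hM0.le
  have hexp : -ε ^ 2 / (2 * ((M * (2 / M / 2) ^ 2 : ℝ≥0) : ℝ)) = -(M : ℝ) * ε ^ 2 / 2 := by
    push_cast
    field_simp
  have hup := hsub.measure_ge_le hε
  have hlo := hsub.neg.measure_ge_le hε
  rw [hexp] at hup hlo
  set S := {X | |F X - p| ≤ ε + (1 - p) / M} with hS
  have hSm : MeasurableSet S := measurableSet_le (by fun_prop) measurable_const
  have hcompl : μ.real Sᶜ ≤ 2 * Real.exp (-(M : ℝ) * ε ^ 2 / 2) := by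
    rw [two_mul]
    refine le_trans (measureReal_mono fun X hX => ?_) ((measureReal_union_le _ _).trans
      (add_le_add hup hlo))
    by_contra hcon
    simp only [Set.mem_union, Set.mem_ofPred_eq, Pi.neg_apply, not_or, not_le] at hcon
    rw [hS, Set.mem_compl_iff, Set.mem_ofPred_eq, abs_le] at hX
    refine hX ⟨?_, ?_⟩
    · linarith [hcon.2]
    · linarith [hcon.1]
  rw [probReal_compl_eq_one_sub hSm] at hcompl
  rw [← ofReal_measureReal]
  exact ENNReal.ofReal_le_ofReal (by linarith)

end VStatistic

section PureState

variable {n : Type*} [Fintype n] {A B : Matrix n n ℂ}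

lemma Matrix.IsHermitian.re_trace_mul (hB : B.IsHermitian) :
    (A * B).trace.re = ∑ i, ∑ j, (A i j * star (B i j)).re := by
  simp only [trace, diag_apply, mul_apply, Complex.re_sum]
  exact Finset.sum_congr rfl fun i _ => Finset.sum_congr rfl fun j _ => by rw [hB.apply]

lemma Matrix.IsHermitian.re_trace_mul_self (hA : A.IsHermitian) :
    (A * A).trace.re = ∑ i, ∑ j, ‖A i j‖ ^ 2 := by
  simp only [hA.re_trace_mul, Complex.star_def, Complex.mul_conj, Complex.ofReal_re,
    Complex.normSq_eq_norm_sq]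

lemma Matrix.IsHermitian.norm_apply_le_one (hA : A.IsHermitian) (h1 : A.trace = 1)
    (hAA : A * A = A) (i j : n) : ‖A i j‖ ≤ 1 := by
  have h : ∑ i, ∑ j, ‖A i j‖ ^ 2 = 1 := by rw [← hA.re_trace_mul_self, hAA, h1, Complex.one_re]
  have hij : ‖A i j‖ ^ 2 ≤ ∑ i, ∑ j, ‖A i j‖ ^ 2 :=
    (Finset.single_le_sum (f := fun j => ‖A i j‖ ^ 2) (fun _ _ => by positivity)
      (Finset.mem_univ j)).trans
    (Finset.single_le_sum (f := fun i => ∑ j, ‖A i j‖ ^ 2) (fun _ _ => by positivity)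
      (Finset.mem_univ i))
  exact (sq_le_one_iff₀ (norm_nonneg _)).1 (hij.trans h.le)

/-- The overlap of two pure states lies in `[0, 1]`. -/
lemma Matrix.PosSemidef.re_trace_mul_mem_Icc (hA : A.PosSemidef) (hB : B.PosSemidef)
    (hA1 : A.trace = 1) (hB1 : B.trace = 1) (hAA : A * A = A) (hBB : B * B = B) :
    (A * B).trace.re ∈ Set.Icc (0 : ℝ) 1 := by
  constructor
  · have h : (A * B).trace = (Aᴴ * B * A).trace := by
      rw [trace_mul_comm (Aᴴ * B), ← Matrix.mul_assoc, hA.1.eq, hAA]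
    rw [h]
    exact (Complex.le_def.1 (hB.conjTranspose_mul_mul_same A).trace_nonneg).1
  · have hA2 : ∑ i, ∑ j, ‖A i j‖ ^ 2 = 1 := by
      rw [← hA.1.re_trace_mul_self, hAA, hA1, Complex.one_re]
    have hB2 : ∑ i, ∑ j, ‖B i j‖ ^ 2 = 1 := by
      rw [← hB.1.re_trace_mul_self, hBB, hB1, Complex.one_re]
    calc (A * B).trace.re = ∑ i, ∑ j, (A i j * star (B i j)).re := hB.1.re_trace_mul
      _ ≤ ∑ i, ∑ j, (‖A i j‖ ^ 2 + ‖B i j‖ ^ 2) / 2 := by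
          gcongr with i _ j _
          refine (Complex.re_le_norm _).trans ?_
          rw [norm_mul, norm_star]
          linarith [two_mul_le_add_sq ‖A i j‖ ‖B i j‖]
      _ = 1 := by
          simp_rw [← Finset.sum_div, Finset.sum_add_distrib]
          rw [hA2, hB2]
          norm_num

end PureState

section Integral

variable {𝒳 n : Type*} [Fintype n] [MeasurableSpace 𝒳] {D : Measure 𝒳} {ρ : 𝒳 → Matrix n n ℂ}

lemma integrable_trace_mul_left (A : Matrix n n ℂ) (hρ : ∀ i j, Integrable (fun x => ρ x i j) D) :
    Integrable (fun x => (A * ρ x).trace) D := by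
  simp only [trace, diag_apply, mul_apply]
  exact integrable_finsetSum _ fun i _ => integrable_finsetSum _ fun j _ => (hρ j i).const_mul _

lemma integral_trace_mul_left (A : Matrix n n ℂ) (hρ : ∀ i j, Integrable (fun x => ρ x i j) D) :
    ∫ x, (A * ρ x).trace ∂D = (A * Matrix.of fun i j => ∫ x, ρ x i j ∂D).trace := by
  simp only [trace, diag_apply, mul_apply, of_apply]
  refine (integral_finsetSum _ fun i _ =>
    integrable_finsetSum _ fun j _ => (hρ j i).const_mul _).trans (Finset.sum_congr rfl fun i _ => ?_)
  exact (integral_finsetSum _ fun j _ => (hρ j i).const_mul _).trans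
    (Finset.sum_congr rfl fun j _ => integral_const_mul _ _)

lemma integral_integral_re_trace_mul (hρ : ∀ i j, Integrable (fun x => ρ x i j) D) :
    ∫ x, ∫ y, (ρ x * ρ y).trace.re ∂D ∂D
      = ((Matrix.of fun i j => ∫ x, ρ x i j ∂D) * Matrix.of fun i j => ∫ x, ρ x i j ∂D).trace.re := by
  set E : Matrix n n ℂ := Matrix.of fun i j => ∫ x, ρ x i j ∂D with hE
  have hint := fun A => integrable_trace_mul_left A hρ
  have h : ∀ A, ∫ y, (A * ρ y).trace.re ∂D = (A * E).trace.re := fun A => by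
    rw [hE, ← integral_trace_mul_left A hρ]
    exact Complex.reCLM.integral_comp_comm (hint A)
  simp_rw [h, trace_mul_comm _ E, h]

end Integral

/-- For i.i.d. samples `x⁽¹⁾,…,x⁽ᴹ⁾ ~ 𝒟` and a measurable family of
pure-state density matrices, with probability at least `1 − 2·exp(−Mε²/2)` the purity of
the empirical average state is within `ε + (1 − Tr[(E[ρ])²])/M` of the purity of the
expected state, and `ε + (1 − Tr[(E[ρ])²])/M ≤ ε + 1/M`. -/
theorem statement19
    {𝒳 : Type*} [MeasurableSpace 𝒳] (D : Measure 𝒳) [IsProbabilityMeasure D]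
    (N M : ℕ) (hM : 1 ≤ M)
    (ρ : 𝒳 → Matrix (Fin N → Fin 2) (Fin N → Fin 2) ℂ)
    (hmeas : ∀ i j, Measurable fun x => ρ x i j)
    -- pure-state density matrices: `ρ(x)² = ρ(x)`, `Tr[ρ(x)] = 1`
    (hρ : ∀ x, (ρ x).PosSemidef ∧ (ρ x).trace = 1 ∧ ρ x * ρ x = ρ x)
    -- the average state of the samples
    (ρbar : (Fin M → 𝒳) → Matrix (Fin N → Fin 2) (Fin N → Fin 2) ℂ)
    (hbar : ∀ X, ρbar X = (M : ℂ)⁻¹ • ∑ m, ρ (X m))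
    -- the expected state, entrywise
    (Eρ : Matrix (Fin N → Fin 2) (Fin N → Fin 2) ℂ)
    (hE : Eρ = Matrix.of fun i j => ∫ x, ρ x i j ∂D)
    (ε : ℝ) (hε : ε ∈ Set.Ioo (0 : ℝ) 1) :
    ENNReal.ofReal (1 - 2 * Real.exp (-(M : ℝ) * ε ^ 2 / 2)) ≤
      (Measure.pi fun _ : Fin M => D)
        {X | |((ρbar X * ρbar X).trace).re - ((Eρ * Eρ).trace).re|
          ≤ ε + (1 - ((Eρ * Eρ).trace).re) / (M : ℝ)} ∧
    ε + (1 - ((Eρ * Eρ).trace).re) / (M : ℝ) ≤ ε + 1 / (M : ℝ) := by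
  have hint : ∀ i j, Integrable (fun x => ρ x i j) D := fun i j =>
    .of_bound (hmeas i j).aestronglyMeasurable 1
      (.of_forall fun x => (hρ x).1.1.norm_apply_le_one (hρ x).2.1 (hρ x).2.2 i j)
  have hEE : (Eρ * Eρ).trace.re = ∫ x, ∫ y, (ρ x * ρ y).trace.re ∂D ∂D := by
    rw [integral_integral_re_trace_mul hint, hE]
  have h01 : ∀ x y, (ρ x * ρ y).trace.re ∈ Set.Icc (0 : ℝ) 1 := fun x y =>
    (hρ x).1.re_trace_mul_mem_Icc (hρ y).1 (hρ x).2.1 (hρ y).2.1 (hρ x).2.2 (hρ y).2.2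
  have hK : Measurable fun p : 𝒳 × 𝒳 => (ρ p.1 * ρ p.2).trace.re := by
    simp only [trace, diag_apply, mul_apply]
    exact Complex.measurable_re.comp <| Finset.measurable_fun_sum _ fun i _ =>
      Finset.measurable_fun_sum _ fun j _ =>
        ((hmeas i j).comp measurable_fst).mul ((hmeas j i).comp measurable_snd)
  have hpurity : ∀ X, (ρbar X * ρbar X).trace.re
      = ((M : ℝ) ^ 2)⁻¹ * ∑ a, ∑ b, (ρ (X a) * ρ (X b)).trace.re := fun X => by
    have hc : (M : ℂ)⁻¹ * (M : ℂ)⁻¹ = (((M : ℝ) ^ 2)⁻¹ : ℝ) := by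
      push_cast
      ring
    rw [hbar, smul_mul_smul_comm, trace_smul, smul_eq_mul, hc, Complex.re_ofReal_mul,
      Finset.sum_mul_sum]
    simp [trace_sum]
  refine ⟨?_, ?_⟩
  · simp_rw [hpurity, hEE]
    exact le_measure_abs_vStatistic_sub_le D hM hK h01
      (fun x => by rw [(hρ x).2.2, (hρ x).2.1, Complex.one_re]) hε.1.le
  · have h0 : 0 ≤ (Eρ * Eρ).trace.re := by
      rw [hEE]
      exact integral_nonneg fun x => integral_nonneg fun y => (h01 x y).1
    gcongr
    linarith
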